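/- Let α ∈ (0,1). For every μ ∈ M_{α,σ} with μ ≠ μ_α one has J(μ) < J(μ_α), and J(μ_α) = C(α), where C(α) = ((1+α)·log(1+α) + (1−α)·log(1−α))/2. In particular μ_α is the unique maximizer of J over M_{α,σ}, and sup_{μ ∈ M_{α,σ}} J(μ) = C(α). -/

import Mathlib

open MeasureTheory Polynomial Filter Set

/-- The `n`-grid: `n` equally spaced points in `[-1,1]` including the endpoints. -/
noncomputable def nGrid (n : ℕ) : Set ℝ :=
  {x | ∃ k : ℕ, 1 ≤ k ∧ k ≤ n ∧ x = (2 * (k : ℝ) - n - 1) / ((n : ℝ) - 1)}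

/-- Uniform norm of a real polynomial on the interval `[-1,1]`. -/
noncomputable def normI (p : Polynomial ℝ) : ℝ :=
  sSup ((fun x => |p.eval x|) '' Set.Icc (-1 : ℝ) 1)

/-- Uniform norm of a real polynomial on the `n`-grid. -/
noncomputable def normE (n : ℕ) (p : Polynomial ℝ) : ℝ :=
  sSup ((fun x => |p.eval x|) '' nGrid n)

/-- The constant `C(α)`. -/
noncomputable def Cconst (α : ℝ) : ℝ :=
  ((1 + α) * Real.log (1 + α) + (1 - α) * Real.log (1 - α)) / 2

/-- The constraining measure `σ`: density `1/2` w.r.t. Lebesgue measure on `[-1,1]`. -/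
noncomputable def sigmaM : Measure ℝ :=
  (2 : ENNReal)⁻¹ • (volume.restrict (Set.Icc (-1 : ℝ) 1))

/-- Logarithmic potential of a measure on `ℝ`. -/
noncomputable def logPot (μ : Measure ℝ) (x : ℝ) : ℝ :=
  ∫ y, Real.log (1 / |x - y|) ∂μ

/-- Topological support of a measure on `ℝ`. -/
def msupport (μ : Measure ℝ) : Set ℝ :=
  {x | ∀ U : Set ℝ, IsOpen U → x ∈ U → μ U ≠ 0}

/-- Normalized zero counting measure (zeros counted with multiplicity,
normalized by `1/n`). -/
noncomputable def zeroMeasure (n : ℕ) (p : Polynomial ℝ) : Measure ℝ :=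
  ((n : ENNReal))⁻¹ • (p.roots.map (fun x => MeasureTheory.Measure.dirac x)).sum

/-- Density of the constrained equilibrium measure `μ_α` (with `r = √(1-α²)`). -/
noncomputable def mualphaDensity (α x : ℝ) : ℝ :=
  if |x| < Real.sqrt (1 - α ^ 2) then
    (1 / Real.pi) * Real.arctan (α / Real.sqrt ((1 - α ^ 2) - x ^ 2))
  else (1 : ℝ) / 2

/-- The constrained equilibrium measure `μ_α` on `[-1,1]`. -/
noncomputable def mualpha (α : ℝ) : Measure ℝ :=
  (volume.restrict (Set.Icc (-1 : ℝ) 1)).withDensity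
    (fun x => ENNReal.ofReal (mualphaDensity α x))

/-- The class of measures `M_{α,σ}`: positive measures on `[-1,1]` with total
mass `α` that are bounded above by `σ`. -/
def Mset (α : ℝ) : Set (Measure ℝ) :=
  {μ | μ ≤ sigmaM ∧ μ Set.univ = ENNReal.ofReal α}

/-- The functional `J`. -/
noncomputable def Jfun (μ : Measure ℝ) : ℝ :=
  sInf (logPot μ '' msupport (sigmaM - μ)) - sInf (logPot μ '' Set.Icc (-1 : ℝ) 1)

lemma sigmaM_le_volume : sigmaM ≤ volume := by
  refine Measure.le_iff.2 fun s _ => ?_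
  simp only [sigmaM, Measure.smul_apply, smul_eq_mul]
  calc (2 : ENNReal)⁻¹ * volume.restrict (Icc (-1 : ℝ) 1) s
      ≤ 1 * volume.restrict (Icc (-1 : ℝ) 1) s := by
        gcongr
        exact ENNReal.inv_le_one.2 one_le_two
    _ ≤ volume s := by
        rw [one_mul]
        exact Measure.restrict_apply_le _ _

lemma sigmaM_univ : sigmaM univ = 1 := by
  simp only [sigmaM, Measure.smul_apply, Measure.restrict_apply_univ, Real.volume_Icc, smul_eq_mul]
  rw [show (1 : ℝ) - -1 = 2 by norm_num, ENNReal.ofReal_ofNat,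
    ENNReal.inv_mul_cancel (by norm_num) (by norm_num)]

instance : IsFiniteMeasure sigmaM := ⟨by rw [sigmaM_univ]; exact ENNReal.one_lt_top⟩

lemma sigmaM_compl_Icc : sigmaM (Icc (-1 : ℝ) 1)ᶜ = 0 := by
  simp [sigmaM]

/-- Potential `∫ log ‖z - y‖ dμ(y)` at complex points, without the minus sign of `logPot`. -/
noncomputable def complexPot (μ : Measure ℝ) (z : ℂ) : ℝ :=
  ∫ y : ℝ, Real.log ‖z - y‖ ∂μ

/-- Potential truncated at radius `R`: the kernel is `log (max R ‖z - y‖)`. -/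
noncomputable def truncPot (μ : Measure ℝ) (R : ℝ) (z : ℂ) : ℝ :=
  ∫ y : ℝ, (Real.log R + Real.posLog (R⁻¹ * ‖z - y‖)) ∂μ

lemma logPot_eq_neg_complexPot (μ : Measure ℝ) (x : ℝ) : logPot μ x = -complexPot μ x := by
  rw [logPot, complexPot, ← integral_neg]
  refine integral_congr_ae (ae_of_all _ fun y => ?_)
  simp only [one_div, Real.log_inv]
  rw [← Complex.ofReal_sub, Complex.norm_real, Real.norm_eq_abs]

lemma integrable_posLog_inv : Integrable (fun s : ℝ => Real.posLog s⁻¹) := by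
  have h : IntegrableOn (fun s : ℝ => Real.posLog s⁻¹) (Ioc (-1) 1) := by
    have hlog : IntegrableOn Real.log (Ioc (-1) 1) :=
      (intervalIntegrable_iff_integrableOn_Ioc_of_le (by norm_num)).1
        intervalIntegral.intervalIntegrable_log'
    refine Integrable.mono hlog ?_ (ae_of_all _ fun s => ?_)
    · exact (Real.continuous_posLog.measurable.comp measurable_inv).aestronglyMeasurable
    · rw [Real.norm_eq_abs, Real.norm_eq_abs, abs_of_nonneg Real.posLog_nonneg, Real.posLog_apply,
        Real.log_inv]
      exact max_le (abs_nonneg _) (neg_le_abs _)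
  refine (integrableOn_iff_integrable_of_support_subset fun s hs => ?_).1
    (h.congr_set_ae Ioc_ae_eq_Icc.symm)
  by_contra hs'
  refine hs ((Real.posLog_eq_zero_iff _).2 ?_)
  have h1 : 1 ≤ |s| := by
    by_contra! hlt
    exact hs' ⟨(abs_lt.1 hlt).1.le, (abs_lt.1 hlt).2.le⟩
  rw [abs_inv]
  exact inv_le_one_of_one_le₀ h1

section DominatedMeasure

variable {μ : Measure ℝ}

lemma isFiniteMeasure_of_le_sigmaM (hμ : μ ≤ sigmaM) : IsFiniteMeasure μ :=
  isFiniteMeasure_of_le sigmaM hμ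

lemma restrict_Icc_of_le_sigmaM (hμ : μ ≤ sigmaM) : μ.restrict (Icc (-1) 1) = μ :=
  Measure.restrict_eq_self_of_ae_mem
    (show ∀ᵐ x ∂μ, x ∈ Icc (-1 : ℝ) 1 from
      le_antisymm ((hμ _).trans_eq sigmaM_compl_Icc) zero_le)

lemma ae_ne_of_le_sigmaM (hμ : μ ≤ sigmaM) (x : ℝ) : ∀ᵐ y ∂μ, y ≠ x := by
  refine le_antisymm (((hμ.trans sigmaM_le_volume) _).trans_eq ?_) zero_le
  simp

lemma ae_norm_sub_pos (hμ : μ ≤ sigmaM) (z : ℂ) : ∀ᵐ y : ℝ ∂μ, 0 < ‖z - y‖ := by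
  filter_upwards [ae_ne_of_le_sigmaM hμ z.re] with y hy
  rw [norm_pos_iff, sub_ne_zero]
  rintro rfl
  simp at hy

lemma log_add_posLog_sub_log {R d : ℝ} (hR : 0 < R) (hd : 0 < d) :
    Real.log R + Real.posLog (R⁻¹ * d) - Real.log d = Real.posLog (R * d⁻¹) := by
  have h := Real.posLog_sub_posLog_inv (x := R⁻¹ * d)
  rw [Real.log_mul (by positivity) (by positivity), Real.log_inv, mul_inv, inv_inv] at h
  linarith

lemma posLog_mul_inv_norm_le {R : ℝ} (hR : 0 < R) (z : ℂ) {y : ℝ} (hy : y ≠ z.re) :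
    Real.posLog (R * ‖z - y‖⁻¹) ≤ Real.posLog ((y - z.re) / R)⁻¹ := by
  rw [← Real.posLog_abs ((y - z.re) / R)⁻¹, abs_inv, abs_div, inv_div, abs_of_pos hR,
    div_eq_mul_inv]
  have h1 : 0 < |y - z.re| := abs_pos.2 (sub_ne_zero.2 hy)
  refine Real.posLog_le_posLog (by positivity) ?_
  gcongr
  have := Complex.abs_re_le_norm (z - y)
  rwa [Complex.sub_re, Complex.ofReal_re, abs_sub_comm] at this

lemma integrable_posLog_div {R : ℝ} (hR : 0 < R) (x : ℝ) :
    Integrable (fun y : ℝ => Real.posLog ((y - x) / R)⁻¹) :=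
  (integrable_posLog_inv.comp_div hR.ne').comp_sub_right x

lemma integral_posLog_div {R : ℝ} (hR : 0 < R) (x : ℝ) :
    ∫ y : ℝ, Real.posLog ((y - x) / R)⁻¹ = R * ∫ s : ℝ, Real.posLog s⁻¹ := by
  rw [integral_sub_right_eq_self (fun y : ℝ => Real.posLog (y / R)⁻¹) x,
    Measure.integral_comp_div (fun y : ℝ => Real.posLog y⁻¹) R, abs_of_pos hR, smul_eq_mul]

lemma measurable_norm_sub_ofReal (z : ℂ) : Measurable fun y : ℝ => ‖z - y‖ := by
  fun_prop

lemma integrable_posLog_mul_inv (hμ : μ ≤ sigmaM) {R : ℝ} (hR : 0 < R) (z : ℂ) :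
    Integrable (fun y : ℝ => Real.posLog (R * ‖z - y‖⁻¹)) μ := by
  refine Integrable.mono' ((integrable_posLog_div hR z.re).mono_measure
    (hμ.trans sigmaM_le_volume)) ?_ ?_
  · exact (Real.continuous_posLog.measurable.comp
      ((measurable_norm_sub_ofReal z).inv.const_mul R)).aestronglyMeasurable
  · filter_upwards [ae_ne_of_le_sigmaM hμ z.re] with y hy
    rw [Real.norm_eq_abs, abs_of_nonneg Real.posLog_nonneg]
    exact posLog_mul_inv_norm_le hR z hy

lemma integral_posLog_mul_inv_le (hμ : μ ≤ sigmaM) {R : ℝ} (hR : 0 < R) (z : ℂ) :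
    ∫ y : ℝ, Real.posLog (R * ‖z - y‖⁻¹) ∂μ ≤ R * ∫ s : ℝ, Real.posLog s⁻¹ := by
  have hvol := hμ.trans sigmaM_le_volume
  calc ∫ y : ℝ, Real.posLog (R * ‖z - y‖⁻¹) ∂μ
      ≤ ∫ y : ℝ, Real.posLog ((y - z.re) / R)⁻¹ ∂μ := by
        refine integral_mono_ae (integrable_posLog_mul_inv hμ hR z)
          ((integrable_posLog_div hR z.re).mono_measure hvol) ?_
        filter_upwards [ae_ne_of_le_sigmaM hμ z.re] with y hy
        exact posLog_mul_inv_norm_le hR z hy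
    _ ≤ ∫ y : ℝ, Real.posLog ((y - z.re) / R)⁻¹ :=
        integral_mono_measure hvol (ae_of_all _ fun _ => Real.posLog_nonneg)
          (integrable_posLog_div hR z.re)
    _ = R * ∫ s : ℝ, Real.posLog s⁻¹ := integral_posLog_div hR z.re

lemma continuous_truncKernel (R : ℝ) :
    Continuous fun p : ℂ × ℝ => Real.log R + Real.posLog (R⁻¹ * ‖p.1 - p.2‖) := by
  fun_prop

lemma integrable_truncKernel (hμ : μ ≤ sigmaM) (R : ℝ) (z : ℂ) :
    Integrable (fun y : ℝ => Real.log R + Real.posLog (R⁻¹ * ‖z - y‖)) μ := by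
  have := isFiniteMeasure_of_le_sigmaM hμ
  rw [← restrict_Icc_of_le_sigmaM hμ]
  exact ((continuous_truncKernel R).comp (Continuous.prodMk_right z)).integrableOn_Icc

lemma continuous_truncPot (hμ : μ ≤ sigmaM) (R : ℝ) : Continuous (truncPot μ R) := by
  have := isFiniteMeasure_of_le_sigmaM hμ
  have h := continuous_parametric_integral_of_continuous (μ := μ)
    (f := fun (z : ℂ) (y : ℝ) => Real.log R + Real.posLog (R⁻¹ * ‖z - y‖))
    (continuous_truncKernel R) (isCompact_Icc (a := (-1 : ℝ)) (b := 1))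
  rwa [restrict_Icc_of_le_sigmaM hμ] at h

lemma integrable_log_norm_sub (hμ : μ ≤ sigmaM) (z : ℂ) :
    Integrable (fun y : ℝ => Real.log ‖z - y‖) μ := by
  refine ((integrable_truncKernel hμ 1 z).sub
    (integrable_posLog_mul_inv hμ one_pos z)).congr ?_
  filter_upwards [ae_norm_sub_pos hμ z] with y hy
  have := log_add_posLog_sub_log one_pos hy
  simp only [Pi.sub_apply]
  linarith

lemma truncPot_sub_complexPot (hμ : μ ≤ sigmaM) {R : ℝ} (hR : 0 < R) (z : ℂ) :
    truncPot μ R z - complexPot μ z = ∫ y : ℝ, Real.posLog (R * ‖z - y‖⁻¹) ∂μ := by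
  rw [truncPot, complexPot,
    ← integral_sub (integrable_truncKernel hμ R z) (integrable_log_norm_sub hμ z)]
  refine integral_congr_ae ?_
  filter_upwards [ae_norm_sub_pos hμ z] with y hy
  exact log_add_posLog_sub_log hR hy

lemma continuous_complexPot (hμ : μ ≤ sigmaM) : Continuous (complexPot μ) := by
  have hlim : Tendsto (fun R : ℝ => R * ∫ s : ℝ, Real.posLog s⁻¹) (nhdsWithin 0 (Ioi 0))
      (nhds 0) := by
    have : Continuous fun R : ℝ => R * ∫ s : ℝ, Real.posLog s⁻¹ := by fun_prop
    simpa using (this.tendsto 0).mono_left nhdsWithin_le_nhds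
  have hunif : TendstoUniformly (truncPot μ) (complexPot μ) (nhdsWithin 0 (Ioi 0)) := by
    rw [Metric.tendstoUniformly_iff]
    intro ε hε
    filter_upwards [hlim.eventually (gt_mem_nhds hε), self_mem_nhdsWithin] with R hRε hR z
    rw [dist_comm, Real.dist_eq, truncPot_sub_complexPot hμ hR,
      abs_of_nonneg (integral_nonneg fun _ => Real.posLog_nonneg)]
    exact (integral_posLog_mul_inv_le hμ hR z).trans_lt hRε
  exact hunif.continuous (Frequently.of_forall fun R => continuous_truncPot hμ R)

lemma circleAverage_complexPot (hμ : μ ≤ sigmaM) (a : ℂ) {R : ℝ} (hR : 0 < R) :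
    Real.circleAverage (complexPot μ) a R = truncPot μ R a := by
  have := isFiniteMeasure_of_le_sigmaM hμ
  have hmeas : Measurable fun p : ℝ × ℝ => Real.log ‖circleMap a R p.1 - p.2‖ := by
    have : Measurable fun p : ℝ × ℝ => circleMap a R p.1 :=
      (continuous_circleMap a R).measurable.comp measurable_fst
    fun_prop
  have hint : Integrable (fun p : ℝ × ℝ => Real.log ‖circleMap a R p.1 - p.2‖)
      ((volume.restrict (Ioc 0 (2 * Real.pi))).prod μ) := by
    refine (integrable_prod_iff hmeas.aestronglyMeasurable).2
      ⟨ae_of_all _ fun θ => integrable_log_norm_sub hμ (circleMap a R θ), ?_⟩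
    have hnorm : ∀ z : ℂ, ∫ y : ℝ, ‖Real.log ‖z - y‖‖ ∂μ =
        2 * truncPot μ 1 z - complexPot μ z := by
      intro z
      rw [truncPot, complexPot, ← integral_const_mul,
        ← integral_sub ((integrable_truncKernel hμ 1 z).const_mul 2) (integrable_log_norm_sub hμ z)]
      refine integral_congr_ae (ae_of_all _ fun y => ?_)
      have := Real.half_mul_log_add_log_abs (x := ‖z - y‖)
      simp only [Real.norm_eq_abs, Real.log_one, inv_one, one_mul, zero_add]
      linarith
    simp only [hnorm]
    have hc : Continuous fun θ : ℝ => 2 * truncPot μ 1 (circleMap a R θ) -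
        complexPot μ (circleMap a R θ) :=
      (((continuous_truncPot hμ 1).comp (continuous_circleMap a R)).const_mul 2).sub
        ((continuous_complexPot hμ).comp (continuous_circleMap a R))
    exact hc.integrableOn_Ioc
  have hpi : (0 : ℝ) ≤ 2 * Real.pi := by positivity
  rw [Real.circleAverage_def, intervalIntegral.integral_of_le hpi, smul_eq_mul]
  simp only [complexPot]
  rw [integral_integral_swap hint, ← integral_const_mul, truncPot]
  refine integral_congr_ae (ae_of_all _ fun y => ?_)
  have := circleAverage_log_norm_sub_const_eq_log_radius_add_posLog (c := a) (a := (y : ℂ)) hR.ne'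
  rw [Real.circleAverage_def, intervalIntegral.integral_of_le hpi, smul_eq_mul] at this
  exact this

end DominatedMeasure
section PotentialDifference

variable {μ ν : Measure ℝ}

lemma abs_log_norm_sub_sub_log_norm_le {z : ℂ} (hz : 2 ≤ ‖z‖) {y : ℝ} (hy : y ∈ Icc (-1 : ℝ) 1) :
    |Real.log ‖z - y‖ - Real.log ‖z‖| ≤ 2 / ‖z‖ := by
  have hy1 : ‖(y : ℂ)‖ ≤ 1 := by
    rw [Complex.norm_real, Real.norm_eq_abs]
    exact abs_le.2 hy
  have hz0 : 0 < ‖z‖ := by linarith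
  have h1 : ‖z - y‖ ≤ ‖z‖ + 1 := (norm_sub_le _ _).trans (by linarith)
  have h2 : ‖z‖ - 1 ≤ ‖z - y‖ := le_trans (by linarith) (norm_sub_norm_le _ _)
  have hd : 0 < ‖z - y‖ := by linarith
  rw [abs_le, ← Real.log_div hd.ne' hz0.ne']
  constructor
  · have h := Real.log_le_sub_one_of_pos (div_pos hz0 hd)
    rw [← inv_div, Real.log_inv] at h
    have h3 : (‖z - y‖ / ‖z‖)⁻¹ - 1 ≤ 2 / ‖z‖ := by
      rw [inv_div, div_sub_one hd.ne', div_le_div_iff₀ hd hz0]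
      nlinarith
    linarith
  · have h := Real.log_le_sub_one_of_pos (div_pos hd hz0)
    have h3 : ‖z - y‖ / ‖z‖ - 1 ≤ 2 / ‖z‖ := by
      rw [div_sub_one hz0.ne']
      gcongr
      linarith
    linarith

lemma tendsto_complexPot_sub_log (hμ : μ ≤ sigmaM) :
    Tendsto (fun z : ℂ => complexPot μ z - μ.real univ * Real.log ‖z‖) (cocompact ℂ) (nhds 0) := by
  have := isFiniteMeasure_of_le_sigmaM hμ
  have hnorm : Tendsto (fun z : ℂ => ‖z‖) (cocompact ℂ) atTop := tendsto_norm_cocompact_atTop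
  have hlim : Tendsto (fun z : ℂ => 2 / ‖z‖ * μ.real univ) (cocompact ℂ) (nhds 0) := by
    simpa using (hnorm.const_div_atTop 2).mul_const (μ.real univ)
  refine squeeze_zero_norm' ?_ hlim
  filter_upwards [hnorm.eventually_ge_atTop 2] with z hz
  have hsub : complexPot μ z - μ.real univ * Real.log ‖z‖ =
      ∫ y : ℝ, (Real.log ‖z - y‖ - Real.log ‖z‖) ∂μ := by
    rw [integral_sub (integrable_log_norm_sub hμ z) (integrable_const _), integral_const,
      smul_eq_mul, complexPot]
  rw [hsub]
  refine norm_integral_le_of_norm_le_const ?_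
  rw [← restrict_Icc_of_le_sigmaM hμ]
  filter_upwards [ae_restrict_mem measurableSet_Icc] with y hy
  exact abs_log_norm_sub_sub_log_norm_le hz hy

/-- The difference of the potentials of `μ` and `ν`, at complex points. -/
noncomputable def potDiff (μ ν : Measure ℝ) (z : ℂ) : ℝ :=
  complexPot ν z - complexPot μ z

lemma continuous_potDiff (hμ : μ ≤ sigmaM) (hν : ν ≤ sigmaM) : Continuous (potDiff μ ν) :=
  (continuous_complexPot hν).sub (continuous_complexPot hμ)

lemma tendsto_potDiff (hμ : μ ≤ sigmaM) (hν : ν ≤ sigmaM) (h : μ univ = ν univ) :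
    Tendsto (potDiff μ ν) (cocompact ℂ) (nhds 0) := by
  have hreal : μ.real univ = ν.real univ := by simp only [measureReal_def, h]
  have := (tendsto_complexPot_sub_log hν).sub (tendsto_complexPot_sub_log hμ)
  rw [sub_zero] at this
  refine this.congr fun z => ?_
  rw [potDiff, hreal]
  ring

lemma circleAverage_potDiff (hμ : μ ≤ sigmaM) (hν : ν ≤ sigmaM) (a : ℂ) {R : ℝ} (hR : 0 < R) :
    Real.circleAverage (potDiff μ ν) a R = truncPot ν R a - truncPot μ R a := by
  rw [← circleAverage_complexPot hμ a hR, ← circleAverage_complexPot hν a hR]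
  exact Real.circleAverage_sub (continuous_complexPot hν).continuousOn.circleIntegrable'
    (continuous_complexPot hμ).continuousOn.circleIntegrable'

/-- Super-mean value property on discs in which `μ` dominates `ν`. -/
lemma circleAverage_potDiff_le (hμ : μ ≤ sigmaM) (hν : ν ≤ sigmaM) {a : ℂ} {R : ℝ} (hR : 0 < R)
    (h : ν.restrict {y : ℝ | ‖a - y‖ < R} ≤ μ.restrict {y : ℝ | ‖a - y‖ < R}) :
    Real.circleAverage (potDiff μ ν) a R ≤ potDiff μ ν a := by
  have hset : ∀ ρ : Measure ℝ, ∫ y in {y : ℝ | ‖a - y‖ < R}, Real.posLog (R * ‖a - y‖⁻¹) ∂ρ =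
      ∫ y : ℝ, Real.posLog (R * ‖a - y‖⁻¹) ∂ρ := by
    intro ρ
    refine setIntegral_eq_integral_of_forall_compl_eq_zero fun y hy => ?_
    have hy' : R ≤ ‖a - y‖ := not_lt.1 hy
    rw [Real.posLog_eq_zero_iff, abs_of_nonneg (by positivity), ← div_eq_mul_inv]
    exact div_le_one_of_le₀ hy' (norm_nonneg _)
  have hmono : ∫ y : ℝ, Real.posLog (R * ‖a - y‖⁻¹) ∂ν ≤
      ∫ y : ℝ, Real.posLog (R * ‖a - y‖⁻¹) ∂μ := by
    rw [← hset ν, ← hset μ]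
    exact integral_mono_measure h (ae_of_all _ fun _ => Real.posLog_nonneg)
      (integrable_posLog_mul_inv hμ hR a).restrict
  rw [← truncPot_sub_complexPot hμ hR, ← truncPot_sub_complexPot hν hR] at hmono
  rw [circleAverage_potDiff hμ hν a hR, potDiff]
  linarith

/-- A continuous function bounded below by its average over a circle is constant on it. -/
lemma eq_of_circleAverage_le {u : ℂ → ℝ} (hu : Continuous u) {m : ℝ} (hm : ∀ z, m ≤ u z) {a : ℂ}
    {R : ℝ} (h : Real.circleAverage u a R ≤ m) (θ : ℝ) : u (circleMap a R θ) = m := by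
  have hpi : 0 < 2 * Real.pi := by positivity
  by_contra hne
  obtain ⟨θ', hθ', hcirc⟩ : ∃ θ' ∈ Ico 0 (2 * Real.pi), circleMap a R θ = circleMap a R θ' := by
    have := (periodic_circleMap a R).exists_mem_Ico₀ hpi θ
    exact this
  rw [hcirc] at hne
  have hlt : ∫ _ in (0 : ℝ)..2 * Real.pi, m < ∫ t in (0 : ℝ)..2 * Real.pi, u (circleMap a R t) :=
    intervalIntegral.integral_lt_integral_of_continuousOn_of_le_of_exists_lt hpi
      continuousOn_const (hu.comp (continuous_circleMap a R)).continuousOn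
      (fun t _ => hm _) ⟨θ', Ico_subset_Icc_self hθ', lt_of_le_of_ne (hm _) (Ne.symm hne)⟩
  rw [Real.circleAverage_def, smul_eq_mul, inv_mul_le_iff₀ hpi] at h
  rw [intervalIntegral.integral_const, sub_zero, smul_eq_mul] at hlt
  exact absurd h (not_le.2 hlt)

lemma eq_of_mem_ball_of_isMin (hμ : μ ≤ sigmaM) (hν : ν ≤ sigmaM) {a : ℂ} {ε : ℝ}
    (h : ν.restrict {y : ℝ | ‖a - y‖ < ε} ≤ μ.restrict {y : ℝ | ‖a - y‖ < ε})
    (hmin : ∀ z, potDiff μ ν a ≤ potDiff μ ν z) {z : ℂ} (hz : z ∈ Metric.ball a ε) :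
    potDiff μ ν z = potDiff μ ν a := by
  rcases eq_or_ne z a with rfl | hza
  · rfl
  have hR : 0 < ‖z - a‖ := norm_pos_iff.2 (sub_ne_zero.2 hza)
  have hRε : ‖z - a‖ < ε := by rwa [← dist_eq_norm]
  have hsub : {y : ℝ | ‖a - y‖ < ‖z - a‖} ⊆ {y : ℝ | ‖a - y‖ < ε} := fun y hy => lt_trans hy hRε
  have h' : ν.restrict {y : ℝ | ‖a - y‖ < ‖z - a‖} ≤ μ.restrict {y : ℝ | ‖a - y‖ < ‖z - a‖} := by
    rw [← Measure.restrict_restrict_of_subset hsub (μ := μ),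
      ← Measure.restrict_restrict_of_subset hsub (μ := ν)]
    exact Measure.restrict_mono_measure h _
  have := eq_of_circleAverage_le (continuous_potDiff hμ hν) hmin
    (circleAverage_potDiff_le hμ hν hR h') (z - a).arg
  rwa [circleMap, Complex.norm_mul_exp_arg_mul_I, add_sub_cancel] at this

lemma restrict_le_restrict_abs_im (a : ℂ) :
    ν.restrict {y : ℝ | ‖a - y‖ < |a.im|} ≤ μ.restrict {y : ℝ | ‖a - y‖ < |a.im|} := by
  have : {y : ℝ | ‖a - y‖ < |a.im|} = ∅ := by
    ext y
    simpa using Complex.abs_im_le_norm (a - y)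
  simp [this]

lemma exists_restrict_le_restrict_norm {U : Set ℝ} (hU : IsOpen U) {x : ℝ} (hx : x ∈ U)
    (h : ν.restrict U ≤ μ.restrict U) :
    ∃ ε > 0, ν.restrict {y : ℝ | ‖(x : ℂ) - y‖ < ε} ≤ μ.restrict {y : ℝ | ‖(x : ℂ) - y‖ < ε} := by
  obtain ⟨ε, hε, hball⟩ := Metric.isOpen_iff.1 hU x hx
  have hsub : {y : ℝ | ‖(x : ℂ) - y‖ < ε} ⊆ U := fun y hy => hball <| by
    rw [Metric.mem_ball, dist_comm, Real.dist_eq]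
    have hy' : ‖(x : ℂ) - y‖ < ε := hy
    rwa [← Complex.ofReal_sub, Complex.norm_real, Real.norm_eq_abs] at hy'
  refine ⟨ε, hε, ?_⟩
  rw [← Measure.restrict_restrict_of_subset hsub (μ := μ),
    ← Measure.restrict_restrict_of_subset hsub (μ := ν)]
  exact Measure.restrict_mono_measure h _

lemma truncPot_zero_of_one_le (hμ : μ ≤ sigmaM) {R : ℝ} (hR : 1 ≤ R) :
    truncPot μ R 0 = μ.real univ * Real.log R := by
  rw [truncPot, ← smul_eq_mul, ← integral_const]
  refine integral_congr_ae ?_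
  rw [← restrict_Icc_of_le_sigmaM hμ]
  filter_upwards [ae_restrict_mem measurableSet_Icc] with y hy
  have hy1 : ‖(0 : ℂ) - y‖ ≤ 1 := by
    rw [zero_sub, norm_neg, Complex.norm_real, Real.norm_eq_abs]
    exact abs_le.2 hy
  rw [add_eq_left, Real.posLog_eq_zero_iff, abs_of_nonneg (by positivity)]
  exact inv_mul_le_one_of_le₀ (hy1.trans hR) (by positivity)

lemma exists_forall_potDiff_le (hμ : μ ≤ sigmaM) (hν : ν ≤ sigmaM) (h : μ univ = ν univ) :
    ∃ a, ∀ z, potDiff μ ν a ≤ potDiff μ ν z := by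
  by_cases hneg : ∃ z, potDiff μ ν z < 0
  · obtain ⟨z₀, hz₀⟩ := hneg
    exact (continuous_potDiff hμ hν).exists_forall_le' z₀
      (((tendsto_potDiff hμ hν h).eventually (lt_mem_nhds hz₀)).mono fun _ => le_of_lt)
  · push Not at hneg
    refine ⟨circleMap 0 2 0, fun z => ?_⟩
    rw [eq_of_circleAverage_le (continuous_potDiff hμ hν) hneg _ 0]
    · exact hneg z
    · rw [circleAverage_potDiff hμ hν 0 two_pos, truncPot_zero_of_one_le hμ one_le_two,
        truncPot_zero_of_one_le hν one_le_two]
      simp only [measureReal_def, h, sub_self, le_refl]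

/-- Minimum principle: the difference of potentials attains its minimum on any nonempty set off
which `μ` dominates `ν`. -/
theorem exists_mem_forall_potDiff_le (hμ : μ ≤ sigmaM) (hν : ν ≤ sigmaM) (h : μ univ = ν univ)
    {S : Set ℝ} (hS : S.Nonempty)
    (hdom : ∀ x ∉ S, ∃ U, IsOpen U ∧ x ∈ U ∧ ν.restrict U ≤ μ.restrict U) :
    ∃ s ∈ S, ∀ z, potDiff μ ν (s : ℝ) ≤ potDiff μ ν z := by
  obtain ⟨a, ha⟩ := exists_forall_potDiff_le hμ hν h
  by_contra! hcon
  have hclopen : IsClopen {z | potDiff μ ν z = potDiff μ ν a} := by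
    refine ⟨isClosed_eq (continuous_potDiff hμ hν) continuous_const,
      Metric.isOpen_iff.2 fun z (hz : potDiff μ ν z = potDiff μ ν a) => ?_⟩
    obtain ⟨ε, hε, hle⟩ : ∃ ε > 0, ν.restrict {y : ℝ | ‖z - y‖ < ε} ≤
        μ.restrict {y : ℝ | ‖z - y‖ < ε} := by
      by_cases him : z.im = 0
      · have hzre : z = (z.re : ℂ) := Complex.ext rfl (by simp [him])
        rw [hzre]
        have hzS : z.re ∉ S := fun hmem => by
          obtain ⟨w, hw⟩ := hcon _ hmem
          rw [← hzre, hz] at hw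
          exact absurd (ha w) (not_le.2 hw)
        obtain ⟨U, hU, hxU, hle⟩ := hdom _ hzS
        exact exists_restrict_le_restrict_norm hU hxU hle
      · exact ⟨|z.im|, abs_pos.2 him, restrict_le_restrict_abs_im z⟩
    exact ⟨ε, hε, fun w hw => (eq_of_mem_ball_of_isMin hμ hν hle (by rwa [hz]) hw).trans hz⟩
  have huniv := hclopen.eq_univ ⟨a, rfl⟩
  obtain ⟨s, hs⟩ := hS
  obtain ⟨w, hw⟩ := hcon s hs
  have hsa : potDiff μ ν s = potDiff μ ν a := huniv.ge (mem_univ (s : ℂ))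
  rw [hsa] at hw
  exact absurd (ha w) (not_le.2 hw)

lemma complexPot_conj (z : ℂ) : complexPot μ (starRingEnd ℂ z) = complexPot μ z := by
  rw [complexPot, complexPot]
  refine integral_congr_ae (ae_of_all _ fun y => ?_)
  have : starRingEnd ℂ z - y = starRingEnd ℂ (z - y) := by simp
  simp only [this, RCLike.norm_conj]

/-- If the minimum is attained at a real point near which `μ` dominates `ν`, then the difference of
potentials is constant. -/
lemma potDiff_eq_of_isMin (hμ : μ ≤ sigmaM) (hν : ν ≤ sigmaM) {x : ℝ}
    (hmin : ∀ z, potDiff μ ν x ≤ potDiff μ ν z)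
    (hdom : ∃ U, IsOpen U ∧ x ∈ U ∧ ν.restrict U ≤ μ.restrict U) (z : ℂ) :
    potDiff μ ν z = potDiff μ ν x := by
  obtain ⟨U, hU, hxU, hle⟩ := hdom
  obtain ⟨ε, hε, hle⟩ := exists_restrict_le_restrict_norm hU hxU hle
  set E : Set ℂ := {z | potDiff μ ν z = potDiff μ ν x}
  have hEclosed : IsClosed E := isClosed_eq (continuous_potDiff hμ hν) continuous_const
  set H : Set ℂ := {z | 0 < z.im}
  have hHopen : IsOpen H := isOpen_lt continuous_const Complex.continuous_im
  have hopen : IsOpen (E ∩ H) := by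
    refine Metric.isOpen_iff.2 fun w ⟨(hw : potDiff μ ν w = _), hwim⟩ => ?_
    obtain ⟨δ, hδ, hball⟩ := Metric.isOpen_iff.1 hHopen w hwim
    refine ⟨min δ |w.im|, lt_min hδ (abs_pos.2 (ne_of_gt hwim)), fun v hv => ?_⟩
    obtain ⟨h1, h2⟩ := lt_min_iff.1 (Metric.mem_ball.1 hv)
    exact ⟨(eq_of_mem_ball_of_isMin hμ hν (restrict_le_restrict_abs_im w)
      (by rwa [hw]) h2).trans hw, hball h1⟩
  have hne : (H ∩ (E ∩ H)).Nonempty := by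
    have him : 0 < ((x : ℂ) + (ε / 2 : ℝ) * Complex.I).im := by simpa using hε
    refine ⟨x + (ε / 2 : ℝ) * Complex.I, him, eq_of_mem_ball_of_isMin hμ hν hle hmin ?_, him⟩
    rw [Metric.mem_ball, dist_eq_norm, add_sub_cancel_left, norm_mul, Complex.norm_I, mul_one,
      Complex.norm_real, Real.norm_eq_abs, abs_of_pos (by positivity)]
    linarith
  have hHE : H ⊆ E ∩ H := (convex_halfSpace_im_gt 0).isPreconnected.subset_of_closure_inter_subset
    hopen hne fun w ⟨hw, hwH⟩ => ⟨closure_minimal inter_subset_left hEclosed hw, hwH⟩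
  have hupper : ∀ w : ℂ, 0 ≤ w.im → w ∈ E := by
    intro w hw
    have : w ∈ closure H := by
      rw [Complex.closure_setOfPred_lt_im]
      exact hw
    exact closure_minimal (hHE.trans inter_subset_left) hEclosed this
  rcases le_total 0 z.im with hz | hz
  · exact hupper z hz
  · have : potDiff μ ν (starRingEnd ℂ z) = _ := hupper (starRingEnd ℂ z) (by simpa using hz)
    rw [potDiff, complexPot_conj, complexPot_conj] at this
    exact this

end PotentialDifference
section Uniqueness

variable {μ ν : Measure ℝ}

lemma log_add_posLog_eq_log_max {R d : ℝ} (hR : 0 < R) (hd : 0 ≤ d) :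
    Real.log R + Real.posLog (R⁻¹ * d) = Real.log (max R d) := by
  rw [Real.posLog_eq_log_max_one (by positivity), ← Real.log_mul hR.ne' (by positivity),
    mul_max_of_nonneg _ _ hR.le, mul_one, mul_inv_cancel_left₀ hR.ne']

/-- Difference quotient in `log R` of the truncated kernel. -/
noncomputable def truncQuot (R r d : ℝ) : ℝ :=
  (Real.log (max R d) - Real.log (max r d)) / (Real.log R - Real.log r)

lemma truncQuot_of_le {R r d : ℝ} (hr : 0 < r) (hrR : r < R) (hd : d ≤ r) :
    truncQuot R r d = 1 := by
  rw [truncQuot, max_eq_left hd, max_eq_left (hd.trans hrR.le),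
    div_self (sub_pos.2 (Real.log_lt_log hr hrR)).ne']

lemma truncQuot_of_ge {R r d : ℝ} (hrR : r < R) (hd : R ≤ d) : truncQuot R r d = 0 := by
  rw [truncQuot, max_eq_right hd, max_eq_right (hrR.le.trans hd), sub_self, zero_div]

lemma abs_truncQuot_le_one {R r d : ℝ} (hr : 0 < r) (hrR : r < R) : |truncQuot R r d| ≤ 1 := by
  rcases le_total d r with hdr | hdr
  · simp [truncQuot_of_le hr hrR hdr]
  rcases le_total R d with hdR | hdR
  · simp [truncQuot_of_ge hrR hdR]
  · have h1 := Real.log_le_log hr hdr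
    have h2 := Real.log_le_log (hr.trans_le hdr) hdR
    have h3 := Real.log_lt_log hr hrR
    rw [truncQuot, max_eq_left hdR, max_eq_right hdr, abs_div, abs_of_pos (sub_pos.2 h3),
      abs_of_nonneg (sub_nonneg.2 h2)]
    exact div_le_one_of_le₀ (by linarith) (by linarith)

lemma integral_truncQuot (hμ : μ ≤ sigmaM) {R r : ℝ} (hR : 0 < R) (hr : 0 < r) (a : ℝ) :
    ∫ y, truncQuot R r |y - a| ∂μ =
      (truncPot μ R a - truncPot μ r a) / (Real.log R - Real.log r) := by
  rw [truncPot, truncPot, ← integral_sub (integrable_truncKernel hμ R a)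
    (integrable_truncKernel hμ r a), ← integral_div]
  refine integral_congr_ae (ae_of_all _ fun y => ?_)
  have hnorm : ‖(a : ℂ) - y‖ = |y - a| := by
    rw [← Complex.ofReal_sub, Complex.norm_real, Real.norm_eq_abs, abs_sub_comm]
  simp only [hnorm]
  rw [log_add_posLog_eq_log_max hR (abs_nonneg _), log_add_posLog_eq_log_max hr (abs_nonneg _),
    truncQuot]

lemma tendsto_integral_truncQuot [IsFiniteMeasure μ] {R : ℝ} (hR : 0 < R) (a : ℝ) :
    Tendsto (fun n : ℕ => ∫ y, truncQuot R (R * (n + 1) / (n + 2)) |y - a| ∂μ) atTop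
      (nhds (μ.real (Metric.ball a R))) := by
  have hr : ∀ n : ℕ, 0 < R * (n + 1) / (n + 2) := fun n => by positivity
  have hrR : ∀ n : ℕ, R * (n + 1) / (n + 2) < R := fun n => by
    rw [div_lt_iff₀ (by positivity)]
    nlinarith
  have hlim : Tendsto (fun n : ℕ => R * (n + 1) / (n + 2)) atTop (nhds R) := by
    have h := (tendsto_const_nhds (x := R)).sub
      ((tendsto_one_div_add_atTop_nhds_zero_nat (𝕜 := ℝ)).comp (tendsto_add_atTop_nat 1) |>.const_mul R)
    rw [mul_zero, sub_zero] at h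
    refine h.congr fun n => ?_
    simp only [Function.comp_apply, Nat.cast_add, Nat.cast_one]
    field_simp
    ring
  rw [← integral_indicator_one Metric.isOpen_ball.measurableSet]
  refine tendsto_integral_of_dominated_convergence (fun _ => 1) (fun n => ?_)
    (integrable_const 1) (fun n => ae_of_all _ fun y => abs_truncQuot_le_one (hr n) (hrR n))
    (ae_of_all _ fun y => ?_)
  · unfold truncQuot
    exact Measurable.aestronglyMeasurable (by fun_prop)
  · by_cases hy : y ∈ Metric.ball a R
    · rw [indicator_of_mem hy, Pi.one_apply]
      rw [Metric.mem_ball, Real.dist_eq] at hy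
      refine tendsto_const_nhds.congr' ?_
      filter_upwards [hlim.eventually (lt_mem_nhds hy)] with n hn
      exact (truncQuot_of_le (hr n) (hrR n) hn.le).symm
    · rw [indicator_of_notMem hy]
      rw [Metric.mem_ball, Real.dist_eq, not_lt] at hy
      exact tendsto_const_nhds.congr fun n => (truncQuot_of_ge (hrR n) hy).symm

/-- A measure below `sigmaM` is determined by its potential, up to an additive constant. -/
theorem eq_of_potDiff_const (hμ : μ ≤ sigmaM) (hν : ν ≤ sigmaM) {m : ℝ}
    (h : ∀ z, potDiff μ ν z = m) : μ = ν := by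
  have := isFiniteMeasure_of_le_sigmaM hμ
  have := isFiniteMeasure_of_le_sigmaM hν
  have htrunc : ∀ (a : ℝ) {R : ℝ}, 0 < R → truncPot ν R a - truncPot μ R a = m := by
    intro a R hR
    rw [← circleAverage_potDiff hμ hν a hR, funext h, Real.circleAverage_const]
  have hball : ∀ (a : ℝ) {R : ℝ}, 0 < R → μ (Metric.ball a R) = ν (Metric.ball a R) := by
    intro a R hR
    rw [← measureReal_eq_measureReal_iff]
    refine tendsto_nhds_unique (tendsto_integral_truncQuot hR a)
      ((tendsto_integral_truncQuot hR a).congr fun n => ?_)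
    have hr : 0 < R * ((n : ℝ) + 1) / (n + 2) := by positivity
    rw [integral_truncQuot hμ hR hr, integral_truncQuot hν hR hr]
    congr 1
    linarith [htrunc a hR, htrunc a hr]
  refine Real.measure_ext_Ioo_rat fun p q => ?_
  rcases le_or_gt q p with hqp | hpq
  · rw [Ioo_eq_empty (by exact_mod_cast hqp.not_gt), measure_empty, measure_empty]
  · rw [Real.Ioo_eq_ball]
    have : (p : ℝ) < q := by exact_mod_cast hpq
    exact hball _ (by linarith)

end Uniqueness
section Arcsine

lemma exists_joukowski_roots {a : ℝ} (ha : 0 < a) (x : ℝ) :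
    ∃ z₁ z₂ : ℂ, a * (z₁ + z₂) = 2 * x ∧ z₁ * z₂ = 1 ∧
      Real.posLog ‖z₁‖ + Real.posLog ‖z₂‖ =
        Real.log ((max a |x| + Real.sqrt (x ^ 2 - a ^ 2)) / a) := by
  have haC : (a : ℂ) ≠ 0 := by exact_mod_cast ha.ne'
  rcases le_total |x| a with hxa | hax
  · have hsq : x ^ 2 ≤ a ^ 2 := sq_le_sq' (abs_le.1 hxa).1 (abs_le.1 hxa).2
    have hroot : x ^ 2 + Real.sqrt (a ^ 2 - x ^ 2) ^ 2 = a ^ 2 := by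
      rw [Real.sq_sqrt (by linarith)]
      ring
    have hrootC : (x : ℂ) ^ 2 + (Real.sqrt (a ^ 2 - x ^ 2) : ℂ) ^ 2 = (a : ℂ) ^ 2 := by
      exact_mod_cast hroot
    set z : ℂ := ⟨x / a, Real.sqrt (a ^ 2 - x ^ 2) / a⟩ with hz
    have hnormSq : Complex.normSq z = 1 := by
      rw [hz, Complex.normSq_mk]
      field_simp
      linarith
    have hnorm : ‖z‖ = 1 := by
      rw [Complex.norm_def, hnormSq, Real.sqrt_one]
    refine ⟨z, starRingEnd ℂ z, ?_, ?_, ?_⟩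
    · rw [Complex.add_conj, hz]
      push_cast
      field_simp
    · rw [Complex.mul_conj, hnormSq, Complex.ofReal_one]
    · rw [RCLike.norm_conj, hnorm, max_eq_left hxa, Real.sqrt_eq_zero_of_nonpos (by linarith),
        add_zero, div_self ha.ne']
      simp
  · have hsq : a ^ 2 ≤ x ^ 2 := sq_le_sq.2 (by rwa [abs_of_pos ha])
    have hroot : Real.sqrt (x ^ 2 - a ^ 2) ^ 2 = |x| ^ 2 - a ^ 2 := by
      rw [Real.sq_sqrt (by linarith), sq_abs]
    obtain ⟨e, he, hxe⟩ : ∃ e : ℝ, e ^ 2 = 1 ∧ x = e * |x| := by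
      rcases abs_choice x with h | h
      · exact ⟨1, by norm_num, by rw [h, one_mul]⟩
      · exact ⟨-1, by norm_num, by rw [h]; ring⟩
    set w : ℝ := (|x| + Real.sqrt (x ^ 2 - a ^ 2)) / a with hw
    have hw1 : 1 ≤ w := by
      rw [hw, le_div_iff₀ ha]
      linarith [Real.sqrt_nonneg (x ^ 2 - a ^ 2)]
    have hsum : a * (w + w⁻¹) = 2 * |x| := by
      have hpos : 0 < |x| + Real.sqrt (x ^ 2 - a ^ 2) :=
        add_pos_of_pos_of_nonneg (ha.trans_le hax) (Real.sqrt_nonneg _)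
      rw [hw, inv_div]
      field_simp
      nlinarith
    have heabs : |e| = 1 := by
      rw [← sq_eq_sq₀ (abs_nonneg e) zero_le_one, sq_abs, he, one_pow]
    refine ⟨((e * w : ℝ) : ℂ), ((e * w⁻¹ : ℝ) : ℂ), ?_, ?_, ?_⟩
    · have : a * (e * w + e * w⁻¹) = 2 * x := by
        rw [hxe]
        linear_combination e * hsum
      exact_mod_cast this
    · have : e * w * (e * w⁻¹) = 1 := by
        field_simp
        exact he
      exact_mod_cast this
    · have hwinv : |w⁻¹| ≤ 1 := by
        rw [abs_of_nonneg (by positivity)]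
        exact inv_le_one_of_one_le₀ hw1
      rw [Complex.norm_real, Complex.norm_real, Real.norm_eq_abs, Real.norm_eq_abs, abs_mul,
        abs_mul, heabs, one_mul, one_mul, Real.posLog_abs, Real.posLog_abs,
        (Real.posLog_eq_zero_iff w⁻¹).2 hwinv,
        Real.posLog_eq_log (by rwa [abs_of_nonneg (by linarith)]), add_zero, max_eq_right hax]

/-- Logarithmic potential of the arcsine distribution on `[-a, a]`. -/
noncomputable def arcsinePot (a x : ℝ) : ℝ :=
  Real.log ((max a |x| + Real.sqrt (x ^ 2 - a ^ 2)) / 2)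

lemma circleAverage_log_abs_sub_mul_re {a : ℝ} (ha : 0 < a) (x : ℝ) :
    Real.circleAverage (fun z : ℂ => Real.log |x - a * z.re|) 0 1 = arcsinePot a x := by
  obtain ⟨z₁, z₂, hsum, hprod, hlog⟩ := exists_joukowski_roots ha x
  have hcongr : (fun z : ℂ => Real.log |x - a * z.re|) =ᶠ[codiscreteWithin (Metric.sphere 0 |1|)]
      fun z => Real.log (a / 2) + (Real.log ‖z - z₁‖ + Real.log ‖z - z₂‖) := by
    rw [(isCompact_sphere _ _).codiscreteWithin_eq]
    refine eventually_inf_principal.2 ?_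
    filter_upwards [(Set.toFinite {z₁, z₂}).compl_mem_cofinite] with z hz hsphere
    have hz1 : z - z₁ ≠ 0 := sub_ne_zero.2 fun h => hz (by simp [h])
    have hz2 : z - z₂ ≠ 0 := sub_ne_zero.2 fun h => hz (by simp [h])
    have hnorm : ‖z‖ = 1 := by simpa using hsphere
    have hconj : z * starRingEnd ℂ z = 1 := by
      rw [Complex.mul_conj, Complex.normSq_eq_norm_sq, hnorm]
      norm_num
    have hre : ((z.re : ℝ) : ℂ) * 2 = z + starRingEnd ℂ z := by
      rw [Complex.add_conj]
      push_cast
      ring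
    have hfactor : z * ((x - a * z.re : ℝ) : ℂ) = -((a / 2 : ℝ) * ((z - z₁) * (z - z₂))) := by
      push_cast
      linear_combination (-(a : ℂ) / 2 * z) * hre - z / 2 * hsum + (a : ℂ) / 2 * hprod
        - (a : ℂ) / 2 * hconj
    have habs : |x - a * z.re| = a / 2 * (‖z - z₁‖ * ‖z - z₂‖) := by
      have := congrArg norm hfactor
      rwa [norm_neg, norm_mul, norm_mul, norm_mul, hnorm, one_mul, Complex.norm_real,
        Complex.norm_real, Real.norm_eq_abs, Real.norm_eq_abs,
        abs_of_pos (show 0 < a / 2 by positivity)] at this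
    rw [habs, Real.log_mul (by positivity) (by positivity), Real.log_mul (by positivity)
      (by positivity)]
  have hint : ∀ w : ℂ, CircleIntegrable (fun z : ℂ => Real.log ‖z - w‖) 0 1 := fun w =>
    circleIntegrable_log_norm_sub_const 1
  have hint₂ : CircleIntegrable (fun z : ℂ => Real.log ‖z - z₁‖ + Real.log ‖z - z₂‖) 0 1 :=
    (hint z₁).add (hint z₂)
  rw [Real.circleAverage_congr_codiscreteWithin hcongr one_ne_zero,
    Real.circleAverage_fun_add (circleIntegrable_const _ _ _) hint₂,
    Real.circleAverage_fun_add (hint z₁) (hint z₂), Real.circleAverage_const,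
    circleAverage_log_norm_sub_const_eq_posLog, circleAverage_log_norm_sub_const_eq_posLog, hlog,
    arcsinePot, ← Real.log_mul (by positivity)]
  · congr 1
    field_simp
  · have : 0 < max a |x| := lt_max_of_lt_left ha
    positivity

lemma integral_log_abs_sub_mul_cos {a : ℝ} (ha : 0 < a) (x : ℝ) :
    ∫ θ in Ioo 0 Real.pi, Real.log |x - a * Real.cos θ| = Real.pi * arcsinePot a x := by
  have havg := circleAverage_log_abs_sub_mul_re ha x
  have hre : ∀ θ : ℝ, (circleMap 0 1 θ).re = Real.cos θ := by
    intro θ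
    simp [circleMap, Complex.exp_ofReal_mul_I_re]
  rw [Real.circleAverage_def, smul_eq_mul] at havg
  simp only [hre] at havg
  have hint : IntervalIntegrable (fun θ => Real.log |x - a * Real.cos θ|) volume 0
      (2 * Real.pi) := by
    have han : MeromorphicOn (fun θ : ℝ => x - a * Real.cos θ) (uIcc 0 (2 * Real.pi)) := by
      intro θ _
      exact (analyticAt_const.sub (analyticAt_const.mul Real.analyticAt_cos)).meromorphicAt
    exact han.intervalIntegrable_log_norm
  have hsub1 : uIcc 0 Real.pi ⊆ uIcc 0 (2 * Real.pi) := by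
    rw [uIcc_of_le Real.pi_pos.le, uIcc_of_le (by positivity)]
    exact Icc_subset_Icc_right (by linarith [Real.pi_pos])
  have hsub2 : uIcc Real.pi (2 * Real.pi) ⊆ uIcc 0 (2 * Real.pi) := by
    rw [uIcc_of_le (by linarith [Real.pi_pos]), uIcc_of_le (by positivity)]
    exact Icc_subset_Icc_left Real.pi_pos.le
  have hsymm : ∫ θ in Real.pi..2 * Real.pi, Real.log |x - a * Real.cos θ| =
      ∫ θ in 0..Real.pi, Real.log |x - a * Real.cos θ| := by
    have := intervalIntegral.integral_comp_sub_left (a := 0) (b := Real.pi)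
      (fun θ => Real.log |x - a * Real.cos θ|) (2 * Real.pi)
    simp only [Real.cos_two_pi_sub, sub_zero] at this
    rw [this]
    congr 1
    ring
  rw [← intervalIntegral.integral_add_adjacent_intervals (hint.mono_set hsub1)
    (hint.mono_set hsub2), hsymm, intervalIntegral.integral_of_le Real.pi_pos.le,
    integral_Ioc_eq_integral_Ioo] at havg
  have hpi := Real.pi_pos
  field_simp at havg
  linarith

end Arcsine
section Equilibrium

lemma image_mul_cos_Ioo {a : ℝ} (ha : 0 < a) :
    (fun θ => a * Real.cos θ) '' Ioo 0 Real.pi = Ioo (-a) a := by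
  ext y
  constructor
  · rintro ⟨θ, hθ, rfl⟩
    have hsin := Real.sin_pos_of_mem_Ioo hθ
    have hsq := Real.sin_sq_add_cos_sq θ
    have hcos : |Real.cos θ| < 1 := by
      rw [← sq_lt_one_iff_abs_lt_one]
      nlinarith
    obtain ⟨h1, h2⟩ := abs_lt.1 hcos
    constructor <;> nlinarith
  · rintro ⟨h1, h2⟩
    have h1' : -1 < y / a := by rw [lt_div_iff₀ ha]; linarith
    have h2' : y / a < 1 := by rw [div_lt_iff₀ ha]; linarith
    refine ⟨Real.arccos (y / a), ⟨Real.arccos_pos.2 h2', ?_⟩, ?_⟩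
    · exact lt_of_le_of_ne (Real.arccos_le_pi _) fun h => (Real.arccos_eq_pi.1 h).not_gt h1'
    · simp only [Real.cos_arccos h1'.le h2'.le]
      field_simp

lemma lintegral_comp_mul_cos {a : ℝ} (ha : 0 < a) (g : ℝ → ENNReal) :
    ∫⁻ θ in Ioo 0 Real.pi, g (a * Real.cos θ) =
      ∫⁻ y in Ioo (-a) a, ENNReal.ofReal (Real.sqrt (a ^ 2 - y ^ 2))⁻¹ * g y := by
  have hderiv : ∀ θ ∈ Ioo 0 Real.pi, HasDerivWithinAt (fun θ => a * Real.cos θ)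
      (a * -Real.sin θ) (Ioo 0 Real.pi) θ := fun θ _ =>
    ((Real.hasDerivAt_cos θ).const_mul a).hasDerivWithinAt
  have hinj : InjOn (fun θ => a * Real.cos θ) (Ioo 0 Real.pi) := fun θ hθ φ hφ h =>
    Real.injOn_cos (Ioo_subset_Icc_self hθ) (Ioo_subset_Icc_self hφ) (mul_left_cancel₀ ha.ne' h)
  rw [← image_mul_cos_Ioo ha,
    lintegral_image_eq_lintegral_abs_deriv_mul measurableSet_Ioo hderiv hinj]
  refine setLIntegral_congr_fun measurableSet_Ioo fun θ hθ => ?_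
  have hsin := Real.sin_pos_of_mem_Ioo hθ
  have hsqrt : Real.sqrt (a ^ 2 - (a * Real.cos θ) ^ 2) = a * Real.sin θ := by
    rw [← Real.sqrt_sq (mul_pos ha hsin).le]
    congr 1
    linear_combination (-a ^ 2) * Real.sin_sq_add_cos_sq θ
  simp only [hsqrt, mul_neg, abs_neg, abs_of_pos (mul_pos ha hsin)]
  rw [← mul_assoc, ← ENNReal.ofReal_mul (mul_pos ha hsin).le,
    mul_inv_cancel₀ (mul_pos ha hsin).ne', ENNReal.ofReal_one, one_mul]

lemma image_mul_sin_Ioo (α : ℝ) {s : ℝ} (hs : 0 < s) :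
    (fun φ => s * Real.sin φ) '' Ioo 0 (Real.arcsin (α / s)) = Ioo 0 (min α s) := by
  have hle : Real.arcsin (α / s) ≤ Real.pi / 2 := Real.arcsin_le_pi_div_two _
  ext t
  constructor
  · rintro ⟨φ, ⟨h0, h1⟩, rfl⟩
    have hmem : φ ∈ Ico (-(Real.pi / 2)) (Real.pi / 2) :=
      ⟨by linarith [Real.pi_pos], h1.trans_le hle⟩
    refine ⟨mul_pos hs (Real.sin_pos_of_pos_of_lt_pi h0 (by linarith [Real.pi_pos])), ?_⟩
    refine lt_min ?_ ?_
    · have := (Real.lt_arcsin_iff_sin_lt' hmem).1 h1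
      rw [lt_div_iff₀ hs] at this
      linarith
    · have : Real.sin φ < 1 := by
        rw [← Real.sin_pi_div_two]
        exact Real.sin_lt_sin_of_lt_of_le_pi_div_two hmem.1 le_rfl hmem.2
      nlinarith
  · rintro ⟨h0, h1⟩
    obtain ⟨h1, h2⟩ := lt_min_iff.1 h1
    have hts : t / s < 1 := (div_lt_one hs).2 h2
    have hts0 : 0 < t / s := div_pos h0 hs
    have hmem : Real.arcsin (t / s) ∈ Ico (-(Real.pi / 2)) (Real.pi / 2) :=
      ⟨Real.neg_pi_div_two_le_arcsin _, Real.arcsin_lt_pi_div_two.2 hts⟩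
    refine ⟨Real.arcsin (t / s), ⟨Real.arcsin_pos.2 hts0, ?_⟩, ?_⟩
    · rw [Real.lt_arcsin_iff_sin_lt' hmem, Real.sin_arcsin (by linarith) hts.le]
      gcongr
    · simp only [Real.sin_arcsin (show -1 ≤ t / s by linarith) hts.le]
      field_simp

lemma lintegral_inv_sqrt_sq_sub_sq (α : ℝ) {s : ℝ} (hs : 0 < s) :
    ∫⁻ t in Ioo 0 α, ENNReal.ofReal (Real.sqrt (s ^ 2 - t ^ 2))⁻¹ =
      ENNReal.ofReal (Real.arcsin (α / s)) := by
  have hle : Real.arcsin (α / s) ≤ Real.pi / 2 := Real.arcsin_le_pi_div_two _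
  have hmin : ∫⁻ t in Ioo 0 α, ENNReal.ofReal (Real.sqrt (s ^ 2 - t ^ 2))⁻¹ =
      ∫⁻ t in Ioo 0 (min α s), ENNReal.ofReal (Real.sqrt (s ^ 2 - t ^ 2))⁻¹ := by
    rw [← lintegral_indicator measurableSet_Ioo, ← lintegral_indicator measurableSet_Ioo]
    congr 1
    ext t
    by_cases ht : t ∈ Ioo 0 (min α s)
    · have ht' : t ∈ Ioo 0 α := ⟨ht.1, ht.2.trans_le (min_le_left _ _)⟩
      rw [indicator_of_mem ht, indicator_of_mem ht']
    · rw [indicator_of_notMem ht, indicator_apply_eq_zero]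
      intro ht'
      have hst : s ≤ t := by
        by_contra! h
        exact ht ⟨ht'.1, lt_min ht'.2 h⟩
      rw [Real.sqrt_eq_zero_of_nonpos (by nlinarith), inv_zero, ENNReal.ofReal_zero]
  have hderiv : ∀ φ ∈ Ioo 0 (Real.arcsin (α / s)), HasDerivWithinAt (fun φ => s * Real.sin φ)
      (s * Real.cos φ) (Ioo 0 (Real.arcsin (α / s))) φ := fun φ _ =>
    ((Real.hasDerivAt_sin φ).const_mul s).hasDerivWithinAt
  have hsub : Ioo 0 (Real.arcsin (α / s)) ⊆ Ioo (-(Real.pi / 2)) (Real.pi / 2) := fun φ hφ =>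
    ⟨by linarith [Real.pi_pos, hφ.1], hφ.2.trans_le hle⟩
  have hinj : InjOn (fun φ => s * Real.sin φ) (Ioo 0 (Real.arcsin (α / s))) := fun φ hφ ψ hψ h =>
    Real.injOn_sin (Ioo_subset_Icc_self (hsub hφ)) (Ioo_subset_Icc_self (hsub hψ))
      (mul_left_cancel₀ hs.ne' h)
  rw [hmin, ← image_mul_sin_Ioo α hs,
    lintegral_image_eq_lintegral_abs_deriv_mul measurableSet_Ioo hderiv hinj]
  have hone : EqOn (fun φ => ENNReal.ofReal |s * Real.cos φ| *
      ENNReal.ofReal (Real.sqrt (s ^ 2 - (s * Real.sin φ) ^ 2))⁻¹) (fun _ => 1)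
      (Ioo 0 (Real.arcsin (α / s))) := by
    intro φ hφ
    have hcos := mul_pos hs (Real.cos_pos_of_mem_Ioo (hsub hφ))
    have hsqrt : Real.sqrt (s ^ 2 - (s * Real.sin φ) ^ 2) = s * Real.cos φ := by
      rw [← Real.sqrt_sq hcos.le]
      congr 1
      linear_combination (-s ^ 2) * Real.sin_sq_add_cos_sq φ
    simp only [hsqrt, abs_of_pos hcos]
    rw [← ENNReal.ofReal_mul hcos.le, mul_inv_cancel₀ hcos.ne', ENNReal.ofReal_one]
  rw [setLIntegral_congr_fun measurableSet_Ioo hone, setLIntegral_one, Real.volume_Ioo, sub_zero]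

lemma mualphaDensity_eq_arcsin {α x : ℝ} (hα : 0 < α) (hx : |x| < 1) :
    mualphaDensity α x = 1 / Real.pi * Real.arcsin (α / Real.sqrt (1 - x ^ 2)) := by
  have hx2 : 0 < 1 - x ^ 2 := by
    have := (sq_lt_one_iff_abs_lt_one x).2 hx
    linarith
  have hs : 0 < Real.sqrt (1 - x ^ 2) := Real.sqrt_pos.2 hx2
  have hs2 : Real.sqrt (1 - x ^ 2) ^ 2 = 1 - x ^ 2 := Real.sq_sqrt hx2.le
  unfold mualphaDensity
  split_ifs with h <;> rw [Real.lt_sqrt (abs_nonneg x), sq_abs] at h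
  · have hαs : α < Real.sqrt (1 - x ^ 2) := by
      rw [Real.lt_sqrt hα.le]
      linarith
    rw [Real.arcsin_eq_arctan ⟨by have := div_pos hα hs; linarith, (div_lt_one hs).2 hαs⟩]
    congr 2
    have : 1 - α ^ 2 - x ^ 2 = Real.sqrt (1 - x ^ 2) ^ 2 * (1 - (α / Real.sqrt (1 - x ^ 2)) ^ 2) := by
      rw [div_pow, hs2]
      field_simp
      ring
    rw [this, Real.sqrt_mul (sq_nonneg _), Real.sqrt_sq hs.le, div_div]
  · have hαs : Real.sqrt (1 - x ^ 2) ≤ α := by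
      rw [Real.sqrt_le_left hα.le]
      linarith
    rw [Real.arcsin_of_one_le ((one_le_div hs).2 hαs)]
    have := Real.pi_pos
    field_simp

end Equilibrium
section ArcsineMixture

lemma lintegral_comp_sqrt_mul_cos {t : ℝ} (ht : t ∈ Ioo (0 : ℝ) 1) (g : ℝ → ENNReal) :
    ∫⁻ θ in Ioo 0 Real.pi, g (Real.sqrt (1 - t ^ 2) * Real.cos θ) =
      ∫⁻ y in Ioo (-1 : ℝ) 1, ENNReal.ofReal (Real.sqrt (1 - t ^ 2 - y ^ 2))⁻¹ * g y := by
  have ht2 : 0 < 1 - t ^ 2 := by nlinarith [ht.1, ht.2]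
  have hs := Real.sqrt_pos.2 ht2
  have hs2 : Real.sqrt (1 - t ^ 2) ^ 2 = 1 - t ^ 2 := Real.sq_sqrt ht2.le
  have hs1 : Real.sqrt (1 - t ^ 2) ≤ 1 := by
    exact Real.sqrt_le_one.2 (by nlinarith)
  rw [lintegral_comp_mul_cos hs, hs2, ← lintegral_indicator measurableSet_Ioo,
    ← lintegral_indicator measurableSet_Ioo]
  congr 1
  ext y
  by_cases hy : y ∈ Ioo (-Real.sqrt (1 - t ^ 2)) (Real.sqrt (1 - t ^ 2))
  · have hy' : y ∈ Ioo (-1 : ℝ) 1 := ⟨by linarith [hy.1], by linarith [hy.2]⟩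
    rw [indicator_of_mem hy, indicator_of_mem hy']
  · rw [indicator_of_notMem hy, eq_comm, indicator_apply_eq_zero]
    intro _
    have hle : 1 - t ^ 2 ≤ y ^ 2 := by
      by_contra! h
      exact hy (abs_lt.1 (Real.lt_sqrt (abs_nonneg y) |>.2 (by rwa [sq_abs])))
    rw [Real.sqrt_eq_zero_of_nonpos (by linarith), inv_zero, ENNReal.ofReal_zero, zero_mul]

lemma measurable_mualphaDensity (α : ℝ) : Measurable (mualphaDensity α) := by
  refine Measurable.ite (measurableSet_lt (by fun_prop) measurable_const) ?_ measurable_const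
  fun_prop

/-- `mualpha α` is a mixture of arcsine distributions on `[-√(1-t²), √(1-t²)]`, `0 < t < α`. -/
lemma mualpha_eq_map {α : ℝ} (hα : α ∈ Ioo (0 : ℝ) 1) :
    mualpha α = Measure.map (fun p : ℝ × ℝ => Real.sqrt (1 - p.1 ^ 2) * Real.cos p.2)
      (ENNReal.ofReal (1 / Real.pi) •
        (volume.restrict (Ioo 0 α)).prod (volume.restrict (Ioo 0 Real.pi))) := by
  have hmeas : Measurable fun p : ℝ × ℝ => Real.sqrt (1 - p.1 ^ 2) * Real.cos p.2 := by fun_prop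
  ext A hA
  set g : ℝ → ENNReal := A.indicator 1 with hg
  have hgm : Measurable g := measurable_one.indicator hA
  rw [← lintegral_indicator_one hA, ← lintegral_indicator_one hA, lintegral_map hgm hmeas,
    lintegral_smul_measure, lintegral_prod _ (by fun_prop)]
  have hinner : ∀ t ∈ Ioo 0 α,
      ∫⁻ θ in Ioo 0 Real.pi, g (Real.sqrt (1 - t ^ 2) * Real.cos θ) =
      ∫⁻ y in Ioo (-1 : ℝ) 1, ENNReal.ofReal (Real.sqrt (1 - t ^ 2 - y ^ 2))⁻¹ * g y :=
    fun t ht => lintegral_comp_sqrt_mul_cos ⟨ht.1, ht.2.trans hα.2⟩ g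
  rw [setLIntegral_congr_fun measurableSet_Ioo hinner, lintegral_lintegral_swap (by fun_prop),
    mualpha, ← Measure.restrict_congr_set Ioo_ae_eq_Icc, lintegral_withDensity_eq_lintegral_mul _
      (measurable_mualphaDensity α).ennreal_ofReal hgm, smul_eq_mul,
    ← lintegral_const_mul _ (by fun_prop)]
  refine setLIntegral_congr_fun measurableSet_Ioo fun y hy => ?_
  have hy2 : 0 < 1 - y ^ 2 := by nlinarith [hy.1, hy.2]
  have hsub : ∀ t : ℝ, 1 - t ^ 2 - y ^ 2 = Real.sqrt (1 - y ^ 2) ^ 2 - t ^ 2 := by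
    intro t
    rw [Real.sq_sqrt hy2.le]
    ring
  simp only [Pi.mul_apply]
  rw [lintegral_mul_const _ (by fun_prop), ← mul_assoc]
  simp only [hsub]
  rw [lintegral_inv_sqrt_sq_sub_sq α (Real.sqrt_pos.2 hy2), ← ENNReal.ofReal_mul (by positivity),
    mualphaDensity_eq_arcsin hα.1 (abs_lt.2 hy)]

lemma mualpha_le_sigmaM (α : ℝ) : mualpha α ≤ sigmaM := by
  have hsigma : sigmaM = (volume.restrict (Icc (-1 : ℝ) 1)).withDensity fun _ => 2⁻¹ := by
    rw [withDensity_const, sigmaM]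
  rw [hsigma, mualpha]
  refine withDensity_mono (ae_restrict_of_forall_mem measurableSet_Icc fun x _ => ?_)
  have hle : mualphaDensity α x ≤ 2⁻¹ := by
    unfold mualphaDensity
    split_ifs
    · have := Real.arctan_lt_pi_div_two (α / Real.sqrt (1 - α ^ 2 - x ^ 2))
      rw [one_div, inv_mul_le_iff₀ Real.pi_pos]
      linarith
    · norm_num
  calc ENNReal.ofReal (mualphaDensity α x) ≤ ENNReal.ofReal 2⁻¹ := ENNReal.ofReal_le_ofReal hle
    _ = 2⁻¹ := by rw [ENNReal.ofReal_inv_of_pos two_pos, ENNReal.ofReal_ofNat]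

lemma mualpha_mem_Mset {α : ℝ} (hα : α ∈ Ioo (0 : ℝ) 1) : mualpha α ∈ Mset α := by
  refine ⟨mualpha_le_sigmaM α, ?_⟩
  rw [mualpha_eq_map hα, Measure.map_apply (by fun_prop) MeasurableSet.univ, preimage_univ,
    Measure.smul_apply, ← univ_prod_univ, Measure.prod_prod, Measure.restrict_apply_univ,
    Measure.restrict_apply_univ, Real.volume_Ioo, Real.volume_Ioo, smul_eq_mul, sub_zero, sub_zero,
    ← ENNReal.ofReal_mul hα.1.le, ← ENNReal.ofReal_mul (by positivity)]
  congr 1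
  field_simp

lemma integrable_arcsinePot_and_complexPot_mualpha {α : ℝ} (hα : α ∈ Ioo (0 : ℝ) 1) (x : ℝ) :
    IntegrableOn (fun t => arcsinePot (Real.sqrt (1 - t ^ 2)) x) (Ioo 0 α) ∧
    complexPot (mualpha α) x = ∫ t in Ioo 0 α, arcsinePot (Real.sqrt (1 - t ^ 2)) x := by
  have hmeas : Measurable fun p : ℝ × ℝ => Real.sqrt (1 - p.1 ^ 2) * Real.cos p.2 := by fun_prop
  have hnorm : ∀ y : ℝ, ‖(x : ℂ) - y‖ = |x - y| := by
    intro y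
    rw [← Complex.ofReal_sub, Complex.norm_real, Real.norm_eq_abs]
  have hint := integrable_log_norm_sub (mualpha_le_sigmaM α) x
  simp only [hnorm] at hint
  have hlog : Measurable fun y : ℝ => Real.log |x - y| := by fun_prop
  have hpi : ENNReal.ofReal (1 / Real.pi) ≠ 0 := by simpa using Real.pi_pos
  rw [mualpha_eq_map hα, integrable_map_measure hlog.aestronglyMeasurable hmeas.aemeasurable,
    integrable_smul_measure hpi ENNReal.ofReal_ne_top] at hint
  have hinner : ∀ t ∈ Ioo 0 α, ∫ θ in Ioo 0 Real.pi,
      Real.log |x - Real.sqrt (1 - t ^ 2) * Real.cos θ| =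
        Real.pi * arcsinePot (Real.sqrt (1 - t ^ 2)) x := fun t ht =>
    integral_log_abs_sub_mul_cos (Real.sqrt_pos.2 (by nlinarith [ht.1, ht.2, hα.2])) x
  constructor
  · have := hint.integral_prod_left.congr (ae_restrict_of_forall_mem measurableSet_Ioo hinner)
    exact (this.const_mul Real.pi⁻¹).congr (ae_of_all _ fun t => by
      simp only [inv_mul_cancel_left₀ Real.pi_pos.ne'])
  · unfold complexPot
    simp only [hnorm]
    rw [mualpha_eq_map hα, integral_map hmeas.aemeasurable hlog.aestronglyMeasurable,
      integral_smul_measure, ENNReal.toReal_ofReal (by positivity)]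
    rw [show ∫ p, Real.log |x - Real.sqrt (1 - p.1 ^ 2) * Real.cos p.2|
          ∂(volume.restrict (Ioo 0 α)).prod (volume.restrict (Ioo 0 Real.pi)) =
        ∫ t in Ioo 0 α, ∫ θ in Ioo 0 Real.pi,
          Real.log |x - Real.sqrt (1 - t ^ 2) * Real.cos θ| from integral_prod _ hint,
      setIntegral_congr_fun measurableSet_Ioo hinner, integral_const_mul, smul_eq_mul,
      ← mul_assoc, one_div_mul_cancel Real.pi_pos.ne', one_mul]

end ArcsineMixture
section EquilibriumPotential

lemma log_half_le_arcsinePot {a : ℝ} (ha : 0 < a) (x : ℝ) :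
    Real.log (a / 2) ≤ arcsinePot a x := by
  refine Real.log_le_log (by positivity) ?_
  linarith [le_max_left a |x|, Real.sqrt_nonneg (x ^ 2 - a ^ 2)]

lemma arcsinePot_eq_of_abs_le {a x : ℝ} (hx : |x| ≤ a) : arcsinePot a x = Real.log (a / 2) := by
  have hsq : x ^ 2 ≤ a ^ 2 := sq_le_sq' (abs_le.1 hx).1 (abs_le.1 hx).2
  rw [arcsinePot, max_eq_left hx, Real.sqrt_eq_zero_of_nonpos (by linarith), add_zero]

lemma sqrt_one_sub_sq_mem_Ioc {t : ℝ} (ht : t ∈ Ioo (0 : ℝ) 1) :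
    Real.sqrt (1 - t ^ 2) ∈ Ioc (0 : ℝ) 1 :=
  ⟨Real.sqrt_pos.2 (by nlinarith [ht.1, ht.2]), Real.sqrt_le_one.2 (by nlinarith [ht.1])⟩

lemma arcsinePot_one {t : ℝ} (ht : t ∈ Ioo (0 : ℝ) 1) :
    arcsinePot (Real.sqrt (1 - t ^ 2)) 1 = Real.log ((1 + t) / 2) := by
  have h : (1 : ℝ) ^ 2 - Real.sqrt (1 - t ^ 2) ^ 2 = t ^ 2 := by
    rw [Real.sq_sqrt (by nlinarith [ht.1, ht.2])]
    ring
  rw [arcsinePot, h, Real.sqrt_sq ht.1.le, abs_one,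
    max_eq_right (sqrt_one_sub_sq_mem_Ioc ht).2]

lemma arcsinePot_le_arcsinePot_one {t x : ℝ} (ht : t ∈ Ioo (0 : ℝ) 1) (hx : |x| ≤ 1) :
    arcsinePot (Real.sqrt (1 - t ^ 2)) x ≤ arcsinePot (Real.sqrt (1 - t ^ 2)) 1 := by
  have ha := (sqrt_one_sub_sq_mem_Ioc ht).1
  have hsq : x ^ 2 ≤ 1 ^ 2 := sq_le_sq.2 (by rwa [abs_one])
  unfold arcsinePot
  refine Real.log_le_log ?_ ?_
  · have : 0 < max (Real.sqrt (1 - t ^ 2)) |x| := lt_max_of_lt_left ha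
    positivity
  · rw [abs_one]
    gcongr

/-- The value of `complexPot (mualpha α)` on `[-√(1-α²), √(1-α²)]`. -/
noncomputable def mualphaLevel (α : ℝ) : ℝ :=
  ∫ t in Ioo 0 α, Real.log (Real.sqrt (1 - t ^ 2) / 2)

lemma mem_Ioo_zero_one_of_mem {α : ℝ} (hα : α ∈ Ioo (0 : ℝ) 1) {t : ℝ}
    (ht : t ∈ Ioo 0 α) : t ∈ Ioo (0 : ℝ) 1 :=
  ⟨ht.1, ht.2.trans hα.2⟩

lemma complexPot_mualpha_of_abs_le {α : ℝ} (hα : α ∈ Ioo (0 : ℝ) 1) {x : ℝ}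
    (hx : |x| ≤ Real.sqrt (1 - α ^ 2)) :
    complexPot (mualpha α) x = mualphaLevel α := by
  rw [(integrable_arcsinePot_and_complexPot_mualpha hα x).2]
  refine setIntegral_congr_fun measurableSet_Ioo fun t ht => ?_
  refine arcsinePot_eq_of_abs_le (hx.trans (Real.sqrt_le_sqrt ?_))
  nlinarith [ht.1, ht.2]

lemma integrableOn_log_sqrt_div {α : ℝ} (hα : α ∈ Ioo (0 : ℝ) 1) :
    IntegrableOn (fun t => Real.log (Real.sqrt (1 - t ^ 2) / 2)) (Ioo 0 α) := by
  refine (integrable_arcsinePot_and_complexPot_mualpha hα 0).1.congr_fun (fun t _ => ?_)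
    measurableSet_Ioo
  exact arcsinePot_eq_of_abs_le (by simp)

lemma mualphaLevel_le_complexPot {α : ℝ} (hα : α ∈ Ioo (0 : ℝ) 1) (x : ℝ) :
    mualphaLevel α ≤ complexPot (mualpha α) x := by
  obtain ⟨hint, heq⟩ := integrable_arcsinePot_and_complexPot_mualpha hα x
  rw [heq]
  exact setIntegral_mono_on (integrableOn_log_sqrt_div hα) hint measurableSet_Ioo fun t ht =>
    log_half_le_arcsinePot (sqrt_one_sub_sq_mem_Ioc (mem_Ioo_zero_one_of_mem hα ht)).1 x

lemma complexPot_mualpha_le_one {α : ℝ} (hα : α ∈ Ioo (0 : ℝ) 1) {x : ℝ} (hx : |x| ≤ 1) :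
    complexPot (mualpha α) x ≤ complexPot (mualpha α) (1 : ℝ) := by
  obtain ⟨hint, heq⟩ := integrable_arcsinePot_and_complexPot_mualpha hα x
  obtain ⟨hint1, heq1⟩ := integrable_arcsinePot_and_complexPot_mualpha hα 1
  rw [heq, heq1]
  exact setIntegral_mono_on hint hint1 measurableSet_Ioo fun t ht =>
    arcsinePot_le_arcsinePot_one (mem_Ioo_zero_one_of_mem hα ht) hx

lemma complexPot_mualpha_one_sub {α : ℝ} (hα : α ∈ Ioo (0 : ℝ) 1) :
    complexPot (mualpha α) (1 : ℝ) - mualphaLevel α =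
      ∫ t in 0..α, (Real.log (1 + t) - Real.log (1 - t)) / 2 := by
  obtain ⟨hint, heq⟩ := integrable_arcsinePot_and_complexPot_mualpha hα 1
  rw [heq, mualphaLevel, ← integral_sub hint (integrableOn_log_sqrt_div hα),
    intervalIntegral.integral_of_le hα.1.le, integral_Ioc_eq_integral_Ioo]
  refine setIntegral_congr_fun measurableSet_Ioo fun t ht => ?_
  have ht1 := mem_Ioo_zero_one_of_mem hα ht
  have hp : 0 < 1 + t := by linarith [ht1.1]
  have hm : 0 < 1 - t := by linarith [ht1.2]
  have hfac : 1 - t ^ 2 = (1 + t) * (1 - t) := by ring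
  simp only [arcsinePot_one ht1]
  rw [Real.log_div hp.ne' two_ne_zero,
    Real.log_div (sqrt_one_sub_sq_mem_Ioc ht1).1.ne' two_ne_zero, hfac,
    Real.log_sqrt (by positivity), Real.log_mul hp.ne' hm.ne']
  ring

lemma hasDerivAt_Cconst {t : ℝ} (ht : t ∈ Ioo (-1 : ℝ) 1) :
    HasDerivAt Cconst ((Real.log (1 + t) - Real.log (1 - t)) / 2) t := by
  have hp : 1 + t ≠ 0 := by linarith [ht.1]
  have hm : 1 - t ≠ 0 := by linarith [ht.2]
  have h1 := (Real.hasDerivAt_mul_log hp).comp t ((hasDerivAt_id t).const_add 1)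
  have h2 := (Real.hasDerivAt_mul_log hm).comp t ((hasDerivAt_id t).const_sub 1)
  refine ((h1.add h2).div_const 2).congr_deriv ?_
  ring

lemma continuousOn_log_sub_log {α : ℝ} (hα : α ∈ Ioo (0 : ℝ) 1) :
    ContinuousOn (fun t => (Real.log (1 + t) - Real.log (1 - t)) / 2) (Icc 0 α) := by
  refine ((ContinuousOn.log (by fun_prop) fun t ht => ?_).sub
    (ContinuousOn.log (by fun_prop) fun t ht => ?_)).div_const 2
  · linarith [ht.1]
  · linarith [ht.2, hα.2]

lemma integral_log_sub_log {α : ℝ} (hα : α ∈ Ioo (0 : ℝ) 1) :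
    ∫ t in 0..α, (Real.log (1 + t) - Real.log (1 - t)) / 2 = Cconst α := by
  have hcont := continuousOn_log_sub_log hα
  rw [intervalIntegral.integral_eq_sub_of_hasDerivAt (f := Cconst)]
  · simp [Cconst]
  · intro t ht
    rw [uIcc_of_le hα.1.le] at ht
    exact hasDerivAt_Cconst ⟨by linarith [ht.1], ht.2.trans_lt hα.2⟩
  · rw [← uIcc_of_le hα.1.le] at hcont
    exact hcont.intervalIntegrable

lemma Cconst_pos {α : ℝ} (hα : α ∈ Ioo (0 : ℝ) 1) : 0 < Cconst α := by
  have hcont := continuousOn_log_sub_log hα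
  rw [← uIcc_of_le hα.1.le] at hcont
  rw [← integral_log_sub_log hα]
  refine intervalIntegral.intervalIntegral_pos_of_pos_on hcont.intervalIntegrable
    (fun t ht => ?_) hα.1
  have := Real.log_lt_log (show 0 < 1 - t by linarith [ht.2, hα.2])
    (show 1 - t < 1 + t by linarith [ht.1])
  linarith

lemma complexPot_mualpha_one {α : ℝ} (hα : α ∈ Ioo (0 : ℝ) 1) :
    complexPot (mualpha α) (1 : ℝ) = mualphaLevel α + Cconst α := by
  rw [← integral_log_sub_log hα, ← complexPot_mualpha_one_sub hα]
  ring

end EquilibriumPotential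
section Support

lemma msupport_eq_support (μ : Measure ℝ) : msupport μ = μ.support := by
  rw [Measure.support_eq_forall_isOpen]
  ext x
  exact ⟨fun h U hx hU => pos_iff_ne_zero.2 (h U hU hx), fun h U hU hx => (h U hx hU).ne'⟩

lemma restrict_le_restrict_of_notMem_msupport {μ ν : Measure ℝ} (hμ : μ ≤ sigmaM)
    (hν : ν ≤ sigmaM) {x : ℝ} (hx : x ∉ msupport (sigmaM - μ)) :
    ∃ U, IsOpen U ∧ x ∈ U ∧ ν.restrict U ≤ μ.restrict U := by
  have := isFiniteMeasure_of_le_sigmaM hμ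
  obtain ⟨U, hU, hxU, h0⟩ : ∃ U : Set ℝ, IsOpen U ∧ x ∈ U ∧ (sigmaM - μ) U = 0 := by
    by_contra! h
    exact hx h
  refine ⟨U, hU, hxU, (Measure.restrict_mono le_rfl hν).trans ?_⟩
  rw [← Measure.sub_add_cancel_of_le hμ, Measure.restrict_add, Measure.restrict_eq_zero.2 h0,
    zero_add]

lemma msupport_sigmaM_sub_subset (μ : Measure ℝ) : msupport (sigmaM - μ) ⊆ Icc (-1) 1 := by
  intro x hx
  by_contra h
  exact hx _ isClosed_Icc.isOpen_compl h
    (le_antisymm ((Measure.sub_le _).trans_eq sigmaM_compl_Icc) zero_le)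

lemma msupport_sigmaM_sub_nonempty {α : ℝ} (hα : α < 1) {μ : Measure ℝ} (hμ : μ ∈ Mset α) :
    (msupport (sigmaM - μ)).Nonempty := by
  have := isFiniteMeasure_of_le_sigmaM hμ.1
  rw [msupport_eq_support]
  refine Measure.nonempty_support fun h => ?_
  have hcancel := Measure.sub_add_cancel_of_le hμ.1
  rw [h, zero_add] at hcancel
  have huniv := hμ.2
  rw [hcancel, sigmaM_univ, eq_comm, ENNReal.ofReal_eq_one] at huniv
  exact hα.ne huniv

lemma abs_le_of_mem_msupport_sigmaM_sub_mualpha {α x : ℝ}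
    (hx : x ∈ msupport (sigmaM - mualpha α)) : |x| ≤ Real.sqrt (1 - α ^ 2) := by
  by_contra! h
  set U : Set ℝ := {y | Real.sqrt (1 - α ^ 2) < |y|}
  have hU : IsOpen U := isOpen_lt continuous_const continuous_abs
  have := isFiniteMeasure_of_le_sigmaM (mualpha_le_sigmaM α)
  have hdens : EqOn (fun y => ENNReal.ofReal (mualphaDensity α y)) (fun _ => 2⁻¹) U := by
    intro y hy
    have hy' : Real.sqrt (1 - α ^ 2) < |y| := hy
    simp only [mualphaDensity, if_neg hy'.not_gt]
    rw [one_div, ENNReal.ofReal_inv_of_pos two_pos, ENNReal.ofReal_ofNat]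
  have heq : mualpha α U = sigmaM U := by
    rw [mualpha, withDensity_apply _ hU.measurableSet,
      setLIntegral_congr_fun hU.measurableSet hdens, setLIntegral_const, sigmaM,
      Measure.smul_apply, smul_eq_mul]
  refine hx U hU h ?_
  rw [Measure.sub_apply hU.measurableSet (mualpha_le_sigmaM α), heq, tsub_self]

end Support

section Maximizer

lemma continuous_logPot {μ : Measure ℝ} (hμ : μ ≤ sigmaM) : Continuous (logPot μ) := by
  have : logPot μ = fun x : ℝ => -complexPot μ x := funext (logPot_eq_neg_complexPot μ)
  rw [this]
  exact ((continuous_complexPot hμ).comp Complex.continuous_ofReal).neg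

lemma Jfun_mualpha {α : ℝ} (hα : α ∈ Ioo (0 : ℝ) 1) : Jfun (mualpha α) = Cconst α := by
  have hsupp : logPot (mualpha α) '' msupport (sigmaM - mualpha α) = {-mualphaLevel α} := by
    rw [← (msupport_sigmaM_sub_nonempty hα.2 (mualpha_mem_Mset hα)).image_const]
    refine image_congr fun x hx => ?_
    rw [logPot_eq_neg_complexPot,
      complexPot_mualpha_of_abs_le hα (abs_le_of_mem_msupport_sigmaM_sub_mualpha hx)]
  have hleast : IsLeast (logPot (mualpha α) '' Icc (-1 : ℝ) 1) (-(mualphaLevel α + Cconst α)) := by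
    rw [← complexPot_mualpha_one hα, ← logPot_eq_neg_complexPot]
    refine ⟨mem_image_of_mem _ (by norm_num), ?_⟩
    rintro _ ⟨x, hx, rfl⟩
    rw [logPot_eq_neg_complexPot, logPot_eq_neg_complexPot, neg_le_neg_iff]
    exact complexPot_mualpha_le_one hα (abs_le.2 hx)
  rw [Jfun, hsupp, csInf_singleton, hleast.csInf_eq]
  ring

lemma Jfun_lt_Cconst {α : ℝ} (hα : α ∈ Ioo (0 : ℝ) 1) {μ : Measure ℝ} (hμ : μ ∈ Mset α)
    (hne : μ ≠ mualpha α) : Jfun μ < Cconst α := by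
  have hC := Cconst_pos hα
  have hμα := mualpha_mem_Mset hα
  have hcont := continuous_logPot hμ.1
  have hbdd : BddBelow (logPot μ '' Icc (-1 : ℝ) 1) :=
    (isCompact_Icc.image hcont).bddBelow
  have hbddS : BddBelow (logPot μ '' msupport (sigmaM - μ)) :=
    hbdd.mono (image_mono (msupport_sigmaM_sub_subset μ))
  have hdom : ∀ x ∉ msupport (sigmaM - μ),
      ∃ U, IsOpen U ∧ x ∈ U ∧ (mualpha α).restrict U ≤ μ.restrict U := fun x hx =>
    restrict_le_restrict_of_notMem_msupport hμ.1 hμα.1 hx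
  obtain ⟨s, hsS, hs⟩ := exists_mem_forall_potDiff_le hμ.1 hμα.1 (hμ.2.trans hμα.2.symm)
    (msupport_sigmaM_sub_nonempty hα.2 hμ) hdom
  obtain ⟨x₀, hx₀, hmin⟩ := isCompact_Icc.exists_isMinOn (nonempty_Icc.2 (by norm_num))
    (hcont.continuousOn (s := Icc (-1 : ℝ) 1))
  have hinf : sInf (logPot μ '' Icc (-1 : ℝ) 1) = logPot μ x₀ := by
    refine IsLeast.csInf_eq ⟨mem_image_of_mem _ hx₀, ?_⟩
    rintro _ ⟨x, hx, rfl⟩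
    exact hmin hx
  have hinfS : ∀ x ∈ msupport (sigmaM - μ),
      sInf (logPot μ '' msupport (sigmaM - μ)) ≤ -complexPot μ x := fun x hx =>
    (csInf_le hbddS (mem_image_of_mem _ hx)).trans_eq (logPot_eq_neg_complexPot μ x)
  have hs₀ := hs x₀
  have hS := hinfS s hsS
  have hlow := mualphaLevel_le_complexPot hα s
  have hupp := complexPot_mualpha_le_one hα (abs_le.2 hx₀)
  rw [complexPot_mualpha_one hα] at hupp
  rw [Jfun, hinf, logPot_eq_neg_complexPot]
  by_contra! hge
  simp only [potDiff] at hs₀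
  by_cases hxS : x₀ ∈ msupport (sigmaM - μ)
  · linarith [hinfS x₀ hxS]
  · refine hne (eq_of_potDiff_const hμ.1 hμα.1
      (potDiff_eq_of_isMin hμ.1 hμα.1 (fun z => le_trans ?_ (hs z)) (hdom x₀ hxS)))
    simp only [potDiff]
    linarith

end Maximizer

theorem mualpha_unique_maximizer_of_J (α : ℝ) (hα : α ∈ Set.Ioo (0 : ℝ) 1) :
    (∀ μ ∈ Mset α, μ ≠ mualpha α → Jfun μ < Jfun (mualpha α)) ∧
    Jfun (mualpha α) = Cconst α ∧
    sSup (Jfun '' Mset α) = Cconst α := by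
  have hJ := Jfun_mualpha hα
  refine ⟨fun μ hμ hne => hJ ▸ Jfun_lt_Cconst hα hμ hne, hJ, IsGreatest.csSup_eq ⟨?_, ?_⟩⟩
  · exact ⟨mualpha α, mualpha_mem_Mset hα, hJ⟩
  · rintro _ ⟨μ, hμ, rfl⟩
    rcases eq_or_ne μ (mualpha α) with rfl | hne
    · exact hJ.le
    · exact (Jfun_lt_Cconst hα hμ hne).le
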